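/- Let a ≥ 1/2, ν > 1/2, y ≥ 0, ρ > 0, and for m ∈ ℕ ∪ {0} define F_m(r) = (sinh r / √(cosh r − cosh ρ)) · ((−∂_r)/sinh r)^m [ (r²+y²)^{-ν/2} K_ν(a √(r²+y²)) ] for r > ρ. Then F_0 is integrable on (ρ, ∞) and ∫_ρ^∞ F_0(r) dr = ∫_ρ^∞ 2 √(cosh r − cosh ρ) · sinh r · ((−∂_r)/sinh r) [ (r²+y²)^{-ν/2} K_ν(a √(r²+y²)) ] dr. -/

import Mathlib

open MeasureTheory Real

noncomputable def besselK (ν ρ : ℝ) : ℝ :=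
  (1 / 2) * (ρ / 2) ^ ν * ∫ t in Set.Ioi (0 : ℝ), Real.exp (-t - ρ ^ 2 / (4 * t)) * t ^ (-ν - 1)

open Set Filter Topology

lemma integrableOn_exp_neg_sub_div_mul_rpow {x : ℝ} (hx : 0 < x) (p : ℝ) :
    IntegrableOn (fun t : ℝ => exp (-t - x / t) * t ^ p) (Ioi 0) := by
  obtain ⟨N, hN⟩ := exists_nat_gt (-p)
  have hΓ := (GammaIntegral_convergent (s := p + N + 1) (by linarith)).const_mul
    ((N.factorial : ℝ) / x ^ N)
  refine Integrable.mono' hΓ (by fun_prop) ?_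
  filter_upwards [ae_restrict_mem measurableSet_Ioi] with t (ht : 0 < t)
  have hpow := pow_div_factorial_le_exp (x / t) (by positivity) N
  have hexp : exp (-(x / t)) ≤ (N.factorial : ℝ) / x ^ N * t ^ N := by
    rw [exp_neg, inv_le_comm₀ (exp_pos _) (by positivity)]
    refine le_trans (le_of_eq ?_) hpow
    rw [div_pow]
    field_simp
  rw [norm_of_nonneg (by positivity), sub_eq_add_neg, exp_add, add_sub_cancel_right,
    rpow_add ht, rpow_natCast]
  calc exp (-t) * exp (-(x / t)) * t ^ p
      ≤ exp (-t) * ((N.factorial : ℝ) / x ^ N * t ^ N) * t ^ p := by gcongr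
    _ = _ := by ring

/-- The integral in the representation of `besselK ν`, as a function of `x = ρ ^ 2 / 4`. -/
noncomputable def besselIntegral (ν x : ℝ) : ℝ :=
  ∫ t in Ioi (0 : ℝ), exp (-t - x / t) * t ^ (-ν - 1)

lemma besselIntegral_nonneg (ν x : ℝ) : 0 ≤ besselIntegral ν x :=
  setIntegral_nonneg measurableSet_Ioi fun _ ht =>
    mul_nonneg (exp_pos _).le (rpow_nonneg (le_of_lt ht) _)

lemma hasDerivAt_besselIntegral (ν : ℝ) {x : ℝ} (hx : 0 < x) :
    HasDerivAt (besselIntegral ν) (-besselIntegral (ν + 1) x) x := by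
  have key := (hasDerivAt_integral_of_dominated_loc_of_deriv_le
    (μ := volume.restrict (Ioi (0 : ℝ)))
    (F := fun x t : ℝ => exp (-t - x / t) * t ^ (-ν - 1))
    (F' := fun x t : ℝ => -(exp (-t - x / t) * t ^ (-(ν + 1) - 1)))
    (bound := fun t : ℝ => exp (-t - (x / 2) / t) * t ^ (-(ν + 1) - 1))
    (Ioi_mem_nhds (half_lt_self hx))
    (Eventually.of_forall fun z => by fun_prop)
    (integrableOn_exp_neg_sub_div_mul_rpow hx _) (by fun_prop) ?_
    (integrableOn_exp_neg_sub_div_mul_rpow (half_pos hx) _) ?_).2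
  · rwa [integral_neg] at key
  · filter_upwards [ae_restrict_mem measurableSet_Ioi] with t (ht : 0 < t) z (hz : x / 2 < z)
    rw [norm_neg, norm_of_nonneg (by positivity)]
    gcongr
  · filter_upwards [ae_restrict_mem measurableSet_Ioi] with t (ht : 0 < t) z _
    have hd := ((((hasDerivAt_id z).div_const t).const_sub (-t)).exp).mul_const (t ^ (-ν - 1))
    refine hd.congr_deriv ?_
    rw [show -(ν + 1) - 1 = (-ν - 1) - 1 by ring, rpow_sub_one ht.ne' (-ν - 1)]
    simp only [id]
    ring

lemma one_add_sq_div_two_le_cosh (w : ℝ) : 1 + w ^ 2 / 2 ≤ cosh w := by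
  have hcosh : cosh w = 1 + 2 * sinh (w / 2) ^ 2 := by
    have h := cosh_two_mul (w / 2)
    rw [mul_div_cancel₀ w two_ne_zero, cosh_sq] at h
    linarith
  have hsq : (w / 2) ^ 2 ≤ sinh (w / 2) ^ 2 := by
    rcases le_total 0 (w / 2) with h | h
    · exact pow_le_pow_left₀ h (self_le_sinh_iff.mpr h) 2
    · have := sinh_le_self_iff.mpr h
      nlinarith
  rw [hcosh]
  linarith

lemma besselIntegral_sq_eq (ν : ℝ) {s : ℝ} (hs : 0 < s) :
    besselIntegral ν (s ^ 2) = ∫ w : ℝ, s ^ (-ν) * exp (-(2 * s * cosh w) - ν * w) := by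
  have himage : (fun w : ℝ => s * exp w) '' univ = Ioi 0 := by
    ext t
    simp only [image_univ, mem_range, mem_Ioi]
    constructor
    · rintro ⟨w, rfl⟩
      positivity
    · intro ht
      exact ⟨log (t / s), by rw [exp_log (by positivity)]; field_simp⟩
  have hinj : InjOn (fun w : ℝ => s * exp w) univ := fun w _ z _ h =>
    exp_injective (mul_left_cancel₀ hs.ne' h)
  rw [besselIntegral, ← himage, integral_image_eq_integral_abs_deriv_smul MeasurableSet.univ
    (fun w _ => ((hasDerivAt_exp w).const_mul s).hasDerivWithinAt) hinj, setIntegral_univ]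
  congr 1 with w
  have hpos : 0 < s * exp w := by positivity
  have hcosh : -(s * exp w) - s ^ 2 / (s * exp w) = -(2 * s * cosh w) := by
    rw [cosh_eq, exp_neg]
    field_simp
    ring
  rw [abs_of_pos hpos, smul_eq_mul, hcosh, rpow_sub_one hpos.ne', mul_rpow hs.le (exp_pos w).le,
    ← exp_mul, sub_eq_add_neg (-(2 * s * cosh w)), exp_add, show w * -ν = -(ν * w) by ring]
  field_simp

lemma besselIntegral_sq_le (ν : ℝ) {s : ℝ} (hs : 0 < s) :
    besselIntegral ν (s ^ 2) ≤
      s ^ (-ν) * exp (-(2 * s)) * exp (ν ^ 2 / (4 * s)) * √(π / s) := by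
  have hint := ((integrable_exp_neg_mul_sq hs).comp_add_right (ν / (2 * s))).const_mul
    (s ^ (-ν) * exp (-(2 * s)) * exp (ν ^ 2 / (4 * s)))
  rw [besselIntegral_sq_eq ν hs]
  refine (integral_mono_of_nonneg (Eventually.of_forall fun w => by positivity) hint
    (Eventually.of_forall fun w => ?_)).trans (le_of_eq ?_)
  · simp only [mul_assoc]
    rw [← exp_add, ← exp_add]
    gcongr
    have h := mul_le_mul_of_nonneg_left (one_add_sq_div_two_le_cosh w) hs.le
    have hsq : ν ^ 2 / (4 * s) + -s * (w + ν / (2 * s)) ^ 2 = -(s * w ^ 2) - ν * w := by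
      field_simp
      ring
    rw [hsq]
    linarith
  · rw [integral_const_mul, integral_add_right_eq_self (fun w => exp (-s * w ^ 2)),
      integral_gaussian]

section IntegrationByParts

variable {ρ : ℝ}

lemma hasDerivAt_two_mul_sqrt_cosh_sub_cosh (hρ : 0 < ρ) {r : ℝ} (hr : ρ < r) :
    HasDerivAt (fun r => 2 * √(cosh r - cosh ρ)) (sinh r / √(cosh r - cosh ρ)) r := by
  have hpos : 0 < cosh r - cosh ρ :=
    sub_pos.mpr (cosh_lt_cosh.mpr (by rwa [abs_of_pos hρ, abs_of_pos (hρ.trans hr)]))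
  refine ((((hasDerivAt_cosh r).sub_const _).sqrt hpos.ne').const_mul 2).congr_deriv ?_
  field_simp

lemma sinh_div_sqrt_cosh_sub_cosh_nonneg (hρ : 0 < ρ) {r : ℝ} (hr : ρ < r) :
    0 ≤ sinh r / √(cosh r - cosh ρ) :=
  div_nonneg (sinh_nonneg_iff.mpr (hρ.trans hr).le) (sqrt_nonneg _)

lemma cosh_le_exp_self {r : ℝ} (hr : 0 ≤ r) : cosh r ≤ exp r := by
  have := exp_le_exp.mpr (show -r ≤ r by linarith)
  rw [cosh_eq]
  linarith

lemma sinh_div_sqrt_cosh_sub_cosh_le (hρ : 0 < ρ) {r : ℝ} (hr : ρ + 2 ≤ r) :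
    sinh r / √(cosh r - cosh ρ) ≤ 2 * exp (r / 2) := by
  have hr0 : 0 < r := by linarith
  have hcosh : 2 * cosh ρ ≤ cosh r := by
    have h1 : cosh (ρ + 2) ≤ cosh r :=
      cosh_le_cosh.mpr (by rwa [abs_of_pos (by linarith), abs_of_pos hr0])
    have h2 := one_add_sq_div_two_le_cosh 2
    have h3 : 0 ≤ sinh ρ * sinh 2 :=
      mul_nonneg (sinh_nonneg_iff.mpr hρ.le) (sinh_nonneg_iff.mpr zero_le_two)
    rw [cosh_add] at h1
    nlinarith [cosh_pos ρ]
  have hsub : (exp (r / 2) / 2) ^ 2 ≤ cosh r - cosh ρ := by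
    have : exp r ≤ 2 * cosh r := by rw [cosh_eq]; linarith [exp_pos (-r)]
    rw [div_pow, ← exp_nat_mul]
    push_cast
    rw [mul_div_cancel₀ r two_ne_zero]
    linarith
  have hsqrt : exp (r / 2) / 2 ≤ √(cosh r - cosh ρ) := le_sqrt_of_sq_le hsub
  have hsinh : sinh r ≤ exp (r / 2) * exp (r / 2) := by
    rw [← exp_add, add_halves]
    exact (sinh_lt_cosh r).le.trans (cosh_le_exp_self hr0.le)
  rw [div_le_iff₀ (lt_of_lt_of_le (by positivity) hsqrt)]
  nlinarith [exp_pos (r / 2)]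

lemma two_mul_sqrt_cosh_sub_cosh_le {r : ℝ} (hr : 0 ≤ r) :
    2 * √(cosh r - cosh ρ) ≤ 2 * exp (r / 2) := by
  gcongr
  rw [sqrt_le_left (exp_pos _).le, ← exp_nat_mul]
  push_cast
  rw [mul_div_cancel₀ r two_ne_zero]
  linarith [cosh_le_exp_self hr, cosh_pos ρ]

variable {g g' : ℝ → ℝ} {C p : ℝ}

lemma integrableOn_sinh_div_sqrt_cosh_sub_cosh_mul (hρ : 0 < ρ) (hp : 1 < p)
    (hg : ContinuousOn g (Ici ρ)) (hg0 : ∀ r, ρ ≤ r → 0 ≤ g r)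
    (hbound : ∀ r, ρ ≤ r → g r ≤ C * (r ^ (-p) * exp (-(r / 2)))) :
    IntegrableOn (fun r => sinh r / √(cosh r - cosh ρ) * g r) (Ioi ρ) := by
  rw [← Ioc_union_Ioi_eq_Ioi (show ρ ≤ ρ + 2 by linarith)]
  refine IntegrableOn.union ?_ ?_
  · have hweight := intervalIntegral.integrableOn_deriv_of_nonneg (a := ρ) (b := ρ + 2)
      (g := fun r => 2 * √(cosh r - cosh ρ)) (g' := fun r => sinh r / √(cosh r - cosh ρ))
      (by fun_prop) (fun r hr => hasDerivAt_two_mul_sqrt_cosh_sub_cosh hρ hr.1)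
      (fun r hr => sinh_div_sqrt_cosh_sub_cosh_nonneg hρ hr.1)
    obtain ⟨M, hM⟩ := isCompact_Icc.exists_bound_of_continuousOn
      (hg.mono (Icc_subset_Ici_self : Icc ρ (ρ + 2) ⊆ Ici ρ))
    refine Integrable.mul_bdd (c := M) hweight ?_ ?_
    · exact (hg.mono fun r hr => le_of_lt hr.1).aestronglyMeasurable measurableSet_Ioc
    · filter_upwards [ae_restrict_mem measurableSet_Ioc] with r hr
      exact hM r (Ioc_subset_Icc_self hr)
  · refine Integrable.mono' ((integrableOn_Ioi_rpow_of_lt (neg_lt_neg hp)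
      (show 0 < ρ + 2 by linarith)).const_mul (2 * C)) ?_ ?_
    · refine AEStronglyMeasurable.mul (Measurable.aestronglyMeasurable (by fun_prop)) ?_
      exact (hg.mono fun r (hr : ρ + 2 < r) => show ρ ≤ r by linarith).aestronglyMeasurable
        measurableSet_Ioi
    · filter_upwards [ae_restrict_mem measurableSet_Ioi] with r (hr : ρ + 2 < r)
      have hρr : ρ < r := by linarith
      rw [norm_of_nonneg
        (mul_nonneg (sinh_div_sqrt_cosh_sub_cosh_nonneg hρ hρr) (hg0 r hρr.le))]
      calc sinh r / √(cosh r - cosh ρ) * g r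
          ≤ 2 * exp (r / 2) * (C * (r ^ (-p) * exp (-(r / 2)))) :=
            mul_le_mul (sinh_div_sqrt_cosh_sub_cosh_le hρ hr.le) (hbound r hρr.le)
              (hg0 r hρr.le) (by positivity)
        _ = 2 * C * r ^ (-p) := by
            rw [exp_neg]
            field_simp

lemma integral_sinh_div_sqrt_cosh_sub_cosh_mul (hρ : 0 < ρ) (hp : 1 < p)
    (hg : ∀ r, ρ ≤ r → HasDerivAt g (g' r) r) (hg' : ∀ r, ρ < r → g' r ≤ 0)
    (hg0 : ∀ r, ρ ≤ r → 0 ≤ g r)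
    (hbound : ∀ r, ρ ≤ r → g r ≤ C * (r ^ (-p) * exp (-(r / 2)))) :
    ∫ r in Ioi ρ, sinh r / √(cosh r - cosh ρ) * g r =
      ∫ r in Ioi ρ, 2 * √(cosh r - cosh ρ) * -g' r := by
  set f : ℝ → ℝ := fun r => sinh r / √(cosh r - cosh ρ) * g r with hf
  have hcont : ContinuousOn g (Ici ρ) := fun r hr => (hg r hr).continuousAt.continuousWithinAt
  have hint : IntegrableOn f (Ioi ρ) :=
    integrableOn_sinh_div_sqrt_cosh_sub_cosh_mul hρ hp hcont hg0 hbound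
  have hfcont : ContinuousOn f (Ioi ρ) := by
    refine ContinuousOn.mul (ContinuousOn.div (by fun_prop) (by fun_prop) fun r hr => ?_)
      (hcont.mono Ioi_subset_Ici_self)
    have hr0 : 0 < r := hρ.trans hr
    exact (sqrt_pos.mpr (sub_pos.mpr (cosh_lt_cosh.mpr
      (by rwa [abs_of_pos hρ, abs_of_pos hr0])))).ne'
  have hderiv : ∀ r ∈ Ioi ρ, HasDerivAt
      (fun r => (∫ t in ρ..r, f t) - 2 * √(cosh r - cosh ρ) * g r)
      (2 * √(cosh r - cosh ρ) * -g' r) r := by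
    intro r (hr : ρ < r)
    have hprim : HasDerivAt (fun r => ∫ t in ρ..r, f t) (f r) r :=
      intervalIntegral.integral_hasDerivAt_right
        ((intervalIntegrable_iff_integrableOn_Ioc_of_le hr.le).mpr
          (hint.mono_set Ioc_subset_Ioi_self))
        (hfcont.stronglyMeasurableAtFilter isOpen_Ioi r hr)
        (hfcont.continuousAt (Ioi_mem_nhds hr))
    refine (hprim.sub
      ((hasDerivAt_two_mul_sqrt_cosh_sub_cosh hρ hr).mul (hg r hr.le))).congr_deriv ?_
    simp only [hf]
    ring
  have hleft : ContinuousWithinAt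
      (fun r => (∫ t in ρ..r, f t) - 2 * √(cosh r - cosh ρ) * g r) (Ici ρ) ρ := by
    refine ContinuousWithinAt.sub ?_ ?_
    · have hle : ρ ≤ ρ + 1 := by linarith
      have h := intervalIntegral.continuousOn_primitive_interval (μ := volume)
        (a := ρ) (b := ρ + 1) (f := f) (by
          rw [uIcc_of_le hle, integrableOn_Icc_iff_integrableOn_Ioc]
          exact hint.mono_set Ioc_subset_Ioi_self)
      rw [uIcc_of_le hle] at h
      exact (h ρ (left_mem_Icc.mpr hle)).mono_of_mem_nhdsWithin
        (Icc_mem_nhdsGE (by linarith))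
    · exact ContinuousWithinAt.mul (by fun_prop) (hcont ρ self_mem_Ici)
  have hboundary : Tendsto (fun r => 2 * √(cosh r - cosh ρ) * g r) atTop (𝓝 0) := by
    have hlim := (tendsto_rpow_neg_atTop (show 0 < p by linarith)).const_mul (2 * C)
    rw [mul_zero] at hlim
    refine squeeze_zero' ?_ ?_ hlim
    · filter_upwards [eventually_ge_atTop ρ] with r hr
      exact mul_nonneg (by positivity) (hg0 r hr)
    · filter_upwards [eventually_ge_atTop ρ] with r hr
      calc 2 * √(cosh r - cosh ρ) * g r
          ≤ 2 * exp (r / 2) * (C * (r ^ (-p) * exp (-(r / 2)))) :=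
            mul_le_mul (two_mul_sqrt_cosh_sub_cosh_le (hρ.le.trans hr)) (hbound r hr)
              (hg0 r hr) (by positivity)
        _ = 2 * C * r ^ (-p) := by
            rw [exp_neg]
            field_simp
  have h := integral_Ioi_of_hasDerivAt_of_nonneg hleft hderiv
    (fun r hr => mul_nonneg (by positivity) (neg_nonneg.mpr (hg' r hr)))
    ((intervalIntegral_tendsto_integral_Ioi ρ hint tendsto_id).sub hboundary)
  rw [h]
  simp

end IntegrationByParts

section RadialProfile

variable {a ν : ℝ} (y : ℝ)

lemma rpow_mul_besselK_eq (ha : 0 < a) {r : ℝ} (hr : 0 < r) :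
    (r ^ 2 + y ^ 2) ^ (-ν / 2) * besselK ν (a * √(r ^ 2 + y ^ 2)) =
      1 / 2 * (a / 2) ^ ν * besselIntegral ν (a ^ 2 * (r ^ 2 + y ^ 2) / 4) := by
  have hq : 0 < r ^ 2 + y ^ 2 := by positivity
  have hsqrt : √(r ^ 2 + y ^ 2) ^ ν = (r ^ 2 + y ^ 2) ^ (ν / 2) := by
    rw [sqrt_eq_rpow, ← rpow_mul hq.le]
    ring_nf
  have hcancel : (r ^ 2 + y ^ 2) ^ (-ν / 2) * (r ^ 2 + y ^ 2) ^ (ν / 2) = 1 := by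
    rw [← rpow_add hq, show -ν / 2 + ν / 2 = 0 by ring, rpow_zero]
  have hint : ∫ t in Ioi (0 : ℝ), exp (-t - (a * √(r ^ 2 + y ^ 2)) ^ 2 / (4 * t)) * t ^ (-ν - 1) =
      besselIntegral ν (a ^ 2 * (r ^ 2 + y ^ 2) / 4) := by
    simp only [besselIntegral, mul_pow, sq_sqrt hq.le, div_div]
  rw [besselK, hint, mul_div_right_comm, mul_rpow (by positivity) (sqrt_nonneg _), hsqrt]
  linear_combination 1 / 2 * (a / 2) ^ ν *
    besselIntegral ν (a ^ 2 * (r ^ 2 + y ^ 2) / 4) * hcancel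

lemma hasDerivAt_rpow_mul_besselK (ha : 0 < a) {r : ℝ} (hr : 0 < r) :
    HasDerivAt (fun r : ℝ => (r ^ 2 + y ^ 2) ^ (-ν / 2) * besselK ν (a * √(r ^ 2 + y ^ 2)))
      (-(1 / 2 * (a / 2) ^ ν *
        (besselIntegral (ν + 1) (a ^ 2 * (r ^ 2 + y ^ 2) / 4) * (a ^ 2 * r / 2)))) r := by
  have hinner : HasDerivAt (fun r : ℝ => a ^ 2 * (r ^ 2 + y ^ 2) / 4) (a ^ 2 * r / 2) r := by
    refine ((((hasDerivAt_pow 2 r).add_const (y ^ 2)).const_mul (a ^ 2)).div_const 4).congr_deriv ?_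
    push_cast
    ring
  have hd := ((hasDerivAt_besselIntegral ν (x := a ^ 2 * (r ^ 2 + y ^ 2) / 4)
    (by positivity)).comp r hinner).const_mul (1 / 2 * (a / 2) ^ ν)
  refine (hd.congr_of_eventuallyEq ?_).congr_deriv (by ring)
  filter_upwards [Ioi_mem_nhds hr] with z hz
  exact rpow_mul_besselK_eq y ha hz

lemma exists_rpow_mul_besselK_le (ha : 1 / 2 ≤ a) (hν : 0 ≤ ν) {ρ : ℝ} (hρ : 0 < ρ) :
    ∃ C, ∀ r, ρ ≤ r → (r ^ 2 + y ^ 2) ^ (-ν / 2) * besselK ν (a * √(r ^ 2 + y ^ 2)) ≤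
      C * (r ^ (-(ν + 1 / 2)) * exp (-(r / 2))) := by
  refine ⟨1 / 2 * (a / 2) ^ ν *
    ((1 / 4) ^ (-(ν + 1 / 2)) * exp (ν ^ 2 / (4 * (ρ / 4))) * √π), fun r hr => ?_⟩
  have ha0 : 0 < a := by linarith
  have hr0 : 0 < r := hρ.trans_le hr
  set s := a * √(r ^ 2 + y ^ 2) / 2 with hs
  have hrs : 1 / 4 * r ≤ s := by
    have h : r ≤ √(r ^ 2 + y ^ 2) := le_sqrt_of_sq_le (by nlinarith [sq_nonneg y])
    rw [hs]
    nlinarith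
  have hs0 : 0 < s := lt_of_lt_of_le (by positivity) hrs
  have hs2 : a ^ 2 * (r ^ 2 + y ^ 2) / 4 = s ^ 2 := by
    rw [hs, div_pow, mul_pow, sq_sqrt (by positivity)]
    norm_num
  have hpow : s ^ (-ν) * √(π / s) = s ^ (-(ν + 1 / 2)) * √π := by
    rw [sqrt_div pi_pos.le, neg_add, rpow_add hs0, rpow_neg hs0.le (1 / 2), ← sqrt_eq_rpow]
    ring
  rw [rpow_mul_besselK_eq y ha0 hr0, hs2, mul_assoc (1 / 2 * (a / 2) ^ ν)]
  gcongr
  calc besselIntegral ν (s ^ 2)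
      ≤ s ^ (-ν) * exp (-(2 * s)) * exp (ν ^ 2 / (4 * s)) * √(π / s) := besselIntegral_sq_le ν hs0
    _ = s ^ (-(ν + 1 / 2)) * exp (-(2 * s)) * exp (ν ^ 2 / (4 * s)) * √π := by
        linear_combination exp (-(2 * s)) * exp (ν ^ 2 / (4 * s)) * hpow
    _ ≤ (1 / 4 * r) ^ (-(ν + 1 / 2)) * exp (-(r / 2)) * exp (ν ^ 2 / (4 * (ρ / 4))) * √π := by
        have h1 : s ^ (-(ν + 1 / 2)) ≤ (1 / 4 * r) ^ (-(ν + 1 / 2)) :=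
          rpow_le_rpow_of_nonpos (by positivity) hrs (by linarith)
        have h2 : -(2 * s) ≤ -(r / 2) := by linarith
        have h3 : ρ / 4 ≤ s := by linarith
        gcongr
    _ = _ := by
        rw [mul_rpow (by norm_num) hr0.le]
        ring

end RadialProfile

theorem stmt_19 (a ν y ρ : ℝ) (ha : 1 / 2 ≤ a) (hν : 1 / 2 < ν) (hy : 0 ≤ y) (hρ : 0 < ρ) :
    IntegrableOn
      (fun r : ℝ => Real.sinh r / Real.sqrt (Real.cosh r - Real.cosh ρ) *
        ((r ^ 2 + y ^ 2) ^ (-ν / 2) * besselK ν (a * Real.sqrt (r ^ 2 + y ^ 2))))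
      (Set.Ioi ρ) ∧
    (∫ r in Set.Ioi ρ, Real.sinh r / Real.sqrt (Real.cosh r - Real.cosh ρ) *
        ((r ^ 2 + y ^ 2) ^ (-ν / 2) * besselK ν (a * Real.sqrt (r ^ 2 + y ^ 2))))
      = ∫ r in Set.Ioi ρ, 2 * Real.sqrt (Real.cosh r - Real.cosh ρ) * Real.sinh r *
          (-(deriv (fun r : ℝ => (r ^ 2 + y ^ 2) ^ (-ν / 2) *
              besselK ν (a * Real.sqrt (r ^ 2 + y ^ 2))) r) / Real.sinh r) := by
  have ha0 : 0 < a := by linarith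
  have hg : ∀ r, ρ ≤ r → HasDerivAt
      (fun r : ℝ => (r ^ 2 + y ^ 2) ^ (-ν / 2) * besselK ν (a * √(r ^ 2 + y ^ 2))) _ r :=
    fun r hr => hasDerivAt_rpow_mul_besselK y ha0 (hρ.trans_le hr)
  have hg0 : ∀ r, ρ ≤ r →
      0 ≤ (r ^ 2 + y ^ 2) ^ (-ν / 2) * besselK ν (a * √(r ^ 2 + y ^ 2)) := fun r hr => by
    rw [rpow_mul_besselK_eq y ha0 (hρ.trans_le hr)]
    exact mul_nonneg (by positivity) (besselIntegral_nonneg _ _)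
  obtain ⟨C, hC⟩ := exists_rpow_mul_besselK_le y ha (show 0 ≤ ν by linarith) hρ
  have hp : 1 < ν + 1 / 2 := by linarith
  refine ⟨integrableOn_sinh_div_sqrt_cosh_sub_cosh_mul hρ hp
    (fun r hr => (hg r hr).continuousAt.continuousWithinAt) hg0 hC, ?_⟩
  rw [integral_sinh_div_sqrt_cosh_sub_cosh_mul hρ hp hg ?_ hg0 hC]
  · refine setIntegral_congr_fun measurableSet_Ioi fun r (hr : ρ < r) => ?_
    have hsinh : sinh r ≠ 0 := (sinh_pos_iff.mpr (hρ.trans hr)).ne'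
    simp only [(hg r hr.le).deriv]
    field_simp
  · intro r hr
    have hr0 : 0 < r := hρ.trans hr
    have := besselIntegral_nonneg (ν + 1) (a ^ 2 * (r ^ 2 + y ^ 2) / 4)
    exact neg_nonpos.mpr (by positivity)
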